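/- (Minkowski inequality.) Let p ∈ (1,∞), let A and B be weighted geometric mean closed Archimedean Φ-algebras, and let T : A → B be a positive linear map. Then for every n ≥ 1 and all a₁, …, aₙ ∈ A, ( T( |Σₖ₌₁ⁿ aₖ|^p ) )^{1/p} ≤ Σₖ₌₁ⁿ ( T(|aₖ|^p) )^{1/p}, where the powers | · |^p are computed in A and the powers ( · )^{1/p} in B, all via the infimum formula for real powers. -/

import Mathlib

/-- The set whose infimum gives the fractional part of the real power `a^r` in a
`Φ`-algebra with unit `1`: with `r̃ = r - ⌊r⌋`, this is
`{ r̃·θ₁·a + (1-r̃)·θ₂·e : θ₁, θ₂ ∈ (0,∞), θ₁^{r̃}·θ₂^{1-r̃} = 1 }`. -/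
def rpowSet {A : Type*} [CommRing A] [Lattice A] [Module ℝ A]
    (a : A) (r : ℝ) : Set A :=
  {x | ∃ θ₁ θ₂ : ℝ, 0 < θ₁ ∧ 0 < θ₂ ∧
      θ₁ ^ (r - (⌊r⌋₊ : ℝ)) * θ₂ ^ (1 - (r - (⌊r⌋₊ : ℝ))) = 1 ∧
      x = ((r - (⌊r⌋₊ : ℝ)) * θ₁) • a + ((1 - (r - (⌊r⌋₊ : ℝ))) * θ₂) • (1 : A)}

/-- `IsRPow a r b` says that `b = a^r` in the sense of Definition 4.3:
`a^r = a^{⌊r⌋} · inf (rpowSet a r)` (with `a^{⌊r⌋} = e` when `⌊r⌋ = 0`). -/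
def IsRPow {A : Type*} [CommRing A] [Lattice A] [Module ℝ A]
    (a : A) (r : ℝ) (b : A) : Prop :=
  ∃ c : A, IsGLB (rpowSet a r) c ∧ b = a ^ ⌊r⌋₊ * c

section Helpers

set_option linter.unusedSectionVars false

variable {A : Type*} [CommRing A] [Lattice A]

lemma mk_ordered [CovariantClass A A (· + ·) (· ≤ ·)] : IsOrderedAddMonoid A where
  add_le_add_left := fun a b h c => by
    rw [add_comm a c, add_comm b c]
    exact CovariantClass.elim c h

lemma mk_mul_disj (hfalg : ∀ a b c : A, a ⊓ b = 0 → 0 ≤ c → (c * a) ⊓ b = 0)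
    {a b : A} (h : a ⊓ b = 0) : a * b = 0 := by
  have ha : 0 ≤ a := h ▸ inf_le_left
  have hb : 0 ≤ b := h ▸ inf_le_right
  have h1 := hfalg a b b h hb
  have h2 := hfalg b (b * a) a (by rw [inf_comm]; exact h1) ha
  rw [mul_comm b a, inf_idem] at h2
  exact h2

lemma mk_pos_neg [IsOrderedAddMonoid A]
    (hfalg : ∀ a b c : A, a ⊓ b = 0 → 0 ≤ c → (c * a) ⊓ b = 0)
    (x : A) : x⁺ * x⁻ = 0 := mk_mul_disj hfalg (posPart_inf_negPart_eq_zero x)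

lemma mk_sq_nonneg [IsOrderedAddMonoid A]
    (hmul : ∀ a b : A, 0 ≤ a → 0 ≤ b → 0 ≤ a * b)
    (hfalg : ∀ a b c : A, a ⊓ b = 0 → 0 ≤ c → (c * a) ⊓ b = 0)
    (x : A) : 0 ≤ x * x := by
  have h := mk_pos_neg hfalg x
  have hx : x * x = x⁺ * x⁺ + x⁻ * x⁻ := by
    have h0 := posPart_sub_negPart x
    calc x * x = (x⁺ - x⁻) * (x⁺ - x⁻) := by rw [h0]
      _ = x⁺ * x⁺ + x⁻ * x⁻ - 2 * (x⁺ * x⁻) := by ring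
      _ = _ := by rw [h]; ring
  rw [hx]
  exact add_nonneg (hmul _ _ (posPart_nonneg x) (posPart_nonneg x))
    (hmul _ _ (negPart_nonneg x) (negPart_nonneg x))

lemma mk_zero_le_one [IsOrderedAddMonoid A]
    (hmul : ∀ a b : A, 0 ≤ a → 0 ≤ b → 0 ≤ a * b)
    (hfalg : ∀ a b c : A, a ⊓ b = 0 → 0 ≤ c → (c * a) ⊓ b = 0) : (0 : A) ≤ 1 := by
  simpa using mk_sq_nonneg hmul hfalg (1 : A)

variable [IsOrderedRing A] [Algebra ℝ A] [PosSMulMono ℝ A]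

lemma mk_C_nonneg {t : ℝ} (ht : 0 ≤ t) : 0 ≤ algebraMap ℝ A t := by
  rw [Algebra.algebraMap_eq_smul_one]
  exact smul_nonneg ht zero_le_one

lemma mk_C_mono {s t : ℝ} (ht : s ≤ t) : algebraMap ℝ A s ≤ algebraMap ℝ A t := by
  rw [← sub_nonneg, ← map_sub]
  exact mk_C_nonneg (sub_nonneg.2 ht)

lemma mk_semiprime (harch : ∀ f g : A, (∀ n : ℕ, (n : ℝ) • f ≤ g) → f ≤ 0)
    (hfalg : ∀ a b c : A, a ⊓ b = 0 → 0 ≤ c → (c * a) ⊓ b = 0)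
    {u : A} (hu : 0 ≤ u) (h : u * u = 0) : u = 0 := by
  have hsq := mk_sq_nonneg (fun a b => mul_nonneg (a := a) (b := b)) hfalg
  have h2 : u + u ≤ 0 := by
    apply harch (u + u) 1
    intro n
    have := hsq (algebraMap ℝ A n * u - 1)
    rw [← sub_nonneg]
    convert this using 1
    rw [Algebra.smul_def]
    linear_combination (- (algebraMap ℝ A n) ^ 2) * h
  exact le_antisymm ((le_add_of_nonneg_left hu).trans h2) hu

lemma mk_step (harch : ∀ f g : A, (∀ n : ℕ, (n : ℝ) • f ≤ g) → f ≤ 0)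
    (hfalg : ∀ a b c : A, a ⊓ b = 0 → 0 ≤ c → (c * a) ⊓ b = 0)
    {X q : A} (hq : 0 ≤ q) (hX : 0 ≤ X * (X⁻ * q)) : X⁻ * q = 0 := by
  have hu := negPart_nonneg X
  have h := mk_pos_neg hfalg X
  have h0 := posPart_sub_negPart X
  have h1 : X * (X⁻ * q) = - (X⁻ * X⁻ * q) := by
    linear_combination (-(X⁻ * q)) * h0 + q * h
  have h2 : X⁻ * X⁻ * q = 0 :=
    le_antisymm (by rw [h1] at hX; exact neg_nonneg.1 hX) (mul_nonneg (mul_nonneg hu hu) hq)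
  apply mk_semiprime harch hfalg (mul_nonneg hu hq)
  linear_combination q * h2

lemma mk_nonneg_of (harch : ∀ f g : A, (∀ n : ℕ, (n : ℝ) • f ≤ g) → f ≤ 0)
    (hfalg : ∀ a b c : A, a ⊓ b = 0 → 0 ≤ c → (c * a) ⊓ b = 0)
    {X : A} (hX : 0 ≤ X * X⁻) : 0 ≤ X := by
  have := mk_step harch hfalg (X := X) (q := 1) zero_le_one (by simpa using hX)
  rw [mul_one] at this
  exact negPart_eq_zero.1 this

/-- approximate form of `g y ≤ (r z + (1-r) y) h`. -/
lemma mk_star_eta (harch : ∀ f g : A, (∀ n : ℕ, (n : ℝ) • f ≤ g) → f ≤ 0)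
    (hfalg : ∀ a b c : A, a ⊓ b = 0 → 0 ≤ c → (c * a) ⊓ b = 0)
    {r : ℝ} (hr0 : 0 < r) (hr1 : r < 1) {g h y z : A}
    (hg0 : 0 ≤ g) (hh0 : 0 ≤ h) (hy : 0 ≤ y) (hz : 0 ≤ z)
    (hg : ∀ s : ℝ, 0 < s → g ≤ algebraMap ℝ A (r * s ^ (r - 1)) * z
      + algebraMap ℝ A ((1 - r) * s ^ r))
    (hh : ∀ s : ℝ, 0 < s → algebraMap ℝ A (s ^ (r - 1)) * (y ⊓ algebraMap ℝ A s) ≤ h)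
    {η : ℝ} (hη : 0 < η) {w : A}
    (hw : w = algebraMap ℝ A r * z + algebraMap ℝ A (1 - r) * y) :
    0 ≤ (1 + algebraMap ℝ A η) * (w * h) + algebraMap ℝ A η * w
      + algebraMap ℝ A η * (y * w) - g * y := by
  set C := algebraMap ℝ A with hC
  have hC0 : ∀ {t : ℝ}, 0 ≤ t → 0 ≤ C t := fun ht => mk_C_nonneg ht
  have hw0 : 0 ≤ w := by
    rw [hw]
    exact add_nonneg (mul_nonneg (hC0 hr0.le) hz) (mul_nonneg (hC0 (by linarith)) hy)
  set X := (1 + C η) * (w * h) + C η * w + C η * (y * w) - g * y with hX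
  have n1 : 0 ≤ (1 + C η) * (w * h) :=
    mul_nonneg (add_nonneg zero_le_one (hC0 hη.le)) (mul_nonneg hw0 hh0)
  have n2 : 0 ≤ C η * w := mul_nonneg (hC0 hη.le) hw0
  have n3 : 0 ≤ C η * (y * w) := mul_nonneg (hC0 hη.le) (mul_nonneg hy hw0)
  have hpow : ∀ s : ℝ, 0 < s → s ^ (r - 1) * s = s ^ r := by
    intro s hs
    rw [← Real.rpow_add_one hs.ne']; congr 1; ring
  -- upper estimate when `y ≥ s` on the support of `v`
  have hup : ∀ (s : ℝ) (v : A), 0 < s → 0 ≤ v → C s * v ≤ y * v →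
      g * y * v ≤ C (s ^ (r - 1)) * (y * w) * v := by
    intro s v hs hv hsv
    have e1 : g * (y * v) ≤ (C (r * s ^ (r - 1)) * z + C ((1 - r) * s ^ r)) * (y * v) :=
      mul_le_mul_of_nonneg_right (hg s hs) (mul_nonneg hy hv)
    have e2 : C ((1 - r) * s ^ (r - 1)) * y * (C s * v)
        ≤ C ((1 - r) * s ^ (r - 1)) * y * (y * v) :=
      mul_le_mul_of_nonneg_left hsv
        (mul_nonneg (hC0 (mul_nonneg (by linarith) (Real.rpow_nonneg hs.le _))) hy)
    rw [← sub_nonneg] at e1 e2 ⊢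
    have := add_nonneg e1 e2
    convert this using 1
    rw [hw, ← hpow s hs]
    simp only [map_mul, map_sub, map_one]
    ring
  -- start
  obtain ⟨δ, hδ, hδη⟩ : ∃ δ : ℝ, 0 < δ ∧ δ ^ r = η :=
    ⟨η ^ (r⁻¹), Real.rpow_pos_of_pos hη _, by
      rw [← Real.rpow_mul hη.le, inv_mul_cancel₀ hr0.ne', Real.rpow_one]⟩
  obtain ⟨M, hM, hMη⟩ : ∃ M : ℝ, 0 < M ∧ M ^ (r - 1) = η :=
    ⟨η ^ ((r - 1)⁻¹), Real.rpow_pos_of_pos hη _, by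
      rw [← Real.rpow_mul hη.le, inv_mul_cancel₀ (by linarith), Real.rpow_one]⟩
  have hpn : ∀ t : ℝ, (C t - y) * (C t - y)⁺ = (C t - y)⁺ * (C t - y)⁺ := by
    intro t
    have h1 := mk_pos_neg hfalg (C t - y)
    have h0 := posPart_sub_negPart (C t - y)
    linear_combination (-(C t - y)⁺) * h0 - h1
  have hu := negPart_nonneg X
  have hvy : ∀ t : ℝ, y * (X⁻ * (C t - y)⁺) ≤ C t * (X⁻ * (C t - y)⁺) := by
    intro t
    rw [← sub_nonneg]
    have : 0 ≤ X⁻ * ((C t - y)⁺ * (C t - y)⁺) :=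
      mul_nonneg hu (mul_nonneg (posPart_nonneg _) (posPart_nonneg _))
    convert this using 1
    rw [← hpn]; ring
  have hlow : ∀ (s : ℝ) (v : A), 0 ≤ v → v * (C s - y)⁺ = 0 → C s * v ≤ y * v := by
    intro s v hv h0
    have h1 := posPart_sub_negPart (C s - y)
    rw [← sub_nonneg]
    have : 0 ≤ v * (C s - y)⁻ := mul_nonneg hv (negPart_nonneg _)
    convert this using 1
    linear_combination v * h1 - h0
  have hP0 : X⁻ * (C δ - y)⁺ = 0 := by
    apply mk_step harch hfalg (posPart_nonneg _)
    have hv0 : 0 ≤ X⁻ * (C δ - y)⁺ := mul_nonneg hu (posPart_nonneg _)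
    have hv1 := hvy δ
    set v := X⁻ * (C δ - y)⁺ with hv
    have e1 : g * (y * v) ≤ (C (r * δ ^ (r - 1)) * z + C ((1 - r) * δ ^ r)) * (y * v) :=
      mul_le_mul_of_nonneg_right (hg δ hδ) (mul_nonneg hy hv0)
    have e2 : C (r * δ ^ (r - 1)) * z * (y * v) ≤ C (r * δ ^ (r - 1)) * z * (C δ * v) :=
      mul_le_mul_of_nonneg_left hv1
        (mul_nonneg (hC0 (mul_nonneg hr0.le (Real.rpow_nonneg hδ.le _))) hz)
    rw [← sub_nonneg] at e1 e2
    have := add_nonneg (add_nonneg e1 e2) (mul_nonneg (add_nonneg n1 n3) hv0)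
    convert this using 1
    rw [hX, hw, ← hδη, ← hpow δ hδ]
    simp only [map_mul, map_sub, map_one]
    ring
  have hP : ∀ i : ℕ, X⁻ * (C (δ * (1 + η) ^ i) - y)⁺ = 0 := by
    intro i
    induction i with
    | zero => simpa using hP0
    | succ i ih =>
      have hs : 0 < δ * (1 + η) ^ i := by positivity
      have ht : δ * (1 + η) ^ (i + 1) = (1 + η) * (δ * (1 + η) ^ i) := by ring
      rw [ht]
      set s := δ * (1 + η) ^ i with hsdef
      apply mk_step harch hfalg (posPart_nonneg _)
      have hv0 : 0 ≤ X⁻ * (C ((1 + η) * s) - y)⁺ := mul_nonneg hu (posPart_nonneg _)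
      have hv1 := hvy ((1 + η) * s)
      have hv2 : X⁻ * (C ((1 + η) * s) - y)⁺ * (C s - y)⁺ = 0 := by
        rw [mul_right_comm, ih, zero_mul]
      set v := X⁻ * (C ((1 + η) * s) - y)⁺ with hv
      have e0 := hup s v hs hv0 (hlow s v hv0 hv2)
      have e1 : C (s ^ (r - 1)) * w * (y * v) ≤ C (s ^ (r - 1)) * w * (C ((1 + η) * s) * v) :=
        mul_le_mul_of_nonneg_left hv1 (mul_nonneg (hC0 (Real.rpow_nonneg hs.le _)) hw0)
      have e2 : C (s ^ (r - 1)) * (y ⊓ C s) * ((1 + C η) * w * v) ≤ h * ((1 + C η) * w * v) :=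
        mul_le_mul_of_nonneg_right (hh s hs)
          (mul_nonneg (mul_nonneg (add_nonneg zero_le_one (hC0 hη.le)) hw0) hv0)
      have e3 : y ⊓ C s = C s - (C s - y)⁺ := by
        have : (C s - y)⁺ = (C s ⊔ y) - y := by
          rw [posPart_def, sup_sub, sub_self]
        have h5 := inf_add_sup y (C s)
        rw [sup_comm] at h5
        rw [this]
        linear_combination h5
      rw [e3] at e2
      rw [← sub_nonneg] at e0 e1 e2
      have := add_nonneg (add_nonneg (add_nonneg e0 e1) e2) (mul_nonneg (add_nonneg n2 n3) hv0)
      convert this using 1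
      rw [hX]
      simp only [map_mul, map_add, map_one]
      linear_combination (-(C (s ^ (r - 1))) * (1 + C η) * w) * hv2
  apply mk_nonneg_of harch hfalg
  obtain ⟨i, hi⟩ : ∃ i : ℕ, M / δ < (1 + η) ^ i := pow_unbounded_of_one_lt _ (by linarith)
  have hs : 0 < δ * (1 + η) ^ i := by positivity
  have hMs : M ≤ δ * (1 + η) ^ i := by
    rw [div_lt_iff₀ hδ] at hi; linarith
  have e0 := hup _ X⁻ hs hu (hlow _ X⁻ hu (hP i))
  have hle : (δ * (1 + η) ^ i) ^ (r - 1) ≤ η := by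
    exact (Real.rpow_le_rpow_of_nonpos hM hMs (by linarith)).trans hMη.le
  have e1 : C ((δ * (1 + η) ^ i) ^ (r - 1)) * (y * w * X⁻) ≤ C η * (y * w * X⁻) :=
    mul_le_mul_of_nonneg_right (mk_C_mono hle) (mul_nonneg (mul_nonneg hy hw0) hu)
  rw [← sub_nonneg] at e0 e1
  have := add_nonneg (add_nonneg e0 e1) (mul_nonneg (add_nonneg n1 n2) hu)
  convert this using 1
  generalize X⁻ = u
  rw [hX]
  ring

lemma mk_star (harch : ∀ f g : A, (∀ n : ℕ, (n : ℝ) • f ≤ g) → f ≤ 0)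
    (hfalg : ∀ a b c : A, a ⊓ b = 0 → 0 ≤ c → (c * a) ⊓ b = 0)
    {r : ℝ} (hr0 : 0 < r) (hr1 : r < 1) {g h y z : A}
    (hg0 : 0 ≤ g) (hh0 : 0 ≤ h) (hy : 0 ≤ y) (hz : 0 ≤ z)
    (hg : ∀ s : ℝ, 0 < s → g ≤ algebraMap ℝ A (r * s ^ (r - 1)) * z
      + algebraMap ℝ A ((1 - r) * s ^ r))
    (hh : ∀ s : ℝ, 0 < s → algebraMap ℝ A (s ^ (r - 1)) * (y ⊓ algebraMap ℝ A s) ≤ h)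
    {w : A} (hw : w = algebraMap ℝ A r * z + algebraMap ℝ A (1 - r) * y) :
    g * y ≤ w * h := by
  have hw0 : 0 ≤ w := by
    rw [hw]
    exact add_nonneg (mul_nonneg (mk_C_nonneg hr0.le) hz)
      (mul_nonneg (mk_C_nonneg (by linarith)) hy)
  have hK : 0 ≤ w * h + w + y * w :=
    add_nonneg (add_nonneg (mul_nonneg hw0 hh0) hw0) (mul_nonneg hy hw0)
  rw [← sub_nonpos]
  apply harch _ (w * h + w + y * w)
  intro n
  rcases Nat.eq_zero_or_pos n with rfl | hn
  · simpa using hK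
  have hn' : (0 : ℝ) < n := by exact_mod_cast hn
  have := mk_star_eta harch hfalg hr0 hr1 hg0 hh0 hy hz hg hh (inv_pos.2 hn') hw
  have h2 := mul_nonneg (mk_C_nonneg (A := A) hn'.le) this
  have h3 : algebraMap ℝ A n * algebraMap ℝ A (n : ℝ)⁻¹ = 1 := by
    rw [← map_mul, mul_inv_cancel₀ hn'.ne', map_one]
  rw [← sub_nonneg, Algebra.smul_def]
  convert h2 using 1
  linear_combination (-(w * h + w + y * w)) * h3

/-- `y^{1+r} ≥ z^r ((1+r) y - r z)`. -/
lemma mk_D1 (harch : ∀ f g : A, (∀ n : ℕ, (n : ℝ) • f ≤ g) → f ≤ 0)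
    (hfalg : ∀ a b c : A, a ⊓ b = 0 → 0 ≤ c → (c * a) ⊓ b = 0)
    {r : ℝ} (hr0 : 0 < r) (hr1 : r < 1) {g h y z : A}
    (hg0 : 0 ≤ g) (hh0 : 0 ≤ h) (hy : 0 ≤ y) (hz : 0 ≤ z)
    (hg : ∀ s : ℝ, 0 < s → g ≤ algebraMap ℝ A (r * s ^ (r - 1)) * z
      + algebraMap ℝ A ((1 - r) * s ^ r))
    (hh : ∀ s : ℝ, 0 < s → algebraMap ℝ A (s ^ (r - 1)) * (y ⊓ algebraMap ℝ A s) ≤ h) :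
    0 ≤ y * h - g * (algebraMap ℝ A (1 + r) * y - algebraMap ℝ A r * z) := by
  have hst := mk_star harch hfalg hr0 hr1 hg0 hh0 hy hz hg hh rfl
  have hsq := mk_sq_nonneg (fun a b => mul_nonneg (a := a) (b := b)) hfalg (y - z)
  set D := y * h - g * (algebraMap ℝ A (1 + r) * y - algebraMap ℝ A r * z) with hD
  have hu := negPart_nonneg D
  have hw1 : 0 ≤ algebraMap ℝ A r * z := mul_nonneg (mk_C_nonneg hr0.le) hz
  have hw2 : 0 ≤ algebraMap ℝ A (1 - r) * y := mul_nonneg (mk_C_nonneg (by linarith)) hy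
  have hDw : 0 ≤ D * (algebraMap ℝ A r * z + algebraMap ℝ A (1 - r) * y) := by
    have e1 := mul_nonneg hy (sub_nonneg.2 hst)
    have e2 := mul_nonneg (mul_nonneg (mk_C_nonneg (A := A) (mul_nonneg hr0.le hr0.le)) hg0) hsq
    convert add_nonneg e1 e2 using 1
    rw [hD]
    simp only [map_mul, map_add, map_sub, map_one]
    ring
  have h0 : D⁻ * (algebraMap ℝ A r * z + algebraMap ℝ A (1 - r) * y) = 0 := by
    apply mk_step harch hfalg (add_nonneg hw1 hw2)
    have := mul_nonneg hDw hu
    convert this using 1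
    ring
  have h1 : D⁻ * (algebraMap ℝ A r * z) = 0 := by
    apply le_antisymm _ (mul_nonneg hu hw1)
    rw [← h0]
    exact mul_le_mul_of_nonneg_left (le_add_of_nonneg_right hw2) hu
  have h2 : D⁻ * (algebraMap ℝ A (1 - r) * y) = 0 := by
    apply le_antisymm _ (mul_nonneg hu hw2)
    rw [← h0]
    exact mul_le_mul_of_nonneg_left (le_add_of_nonneg_left hw1) hu
  have h3 : D⁻ * y = 0 := by
    have h4 : algebraMap ℝ A (1 - r)⁻¹ * algebraMap ℝ A (1 - r) = 1 := by
      rw [← map_mul, inv_mul_cancel₀ (by linarith), map_one]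
    linear_combination algebraMap ℝ A (1 - r)⁻¹ * h2 - (D⁻ * y) * h4
  apply mk_nonneg_of harch hfalg
  apply le_of_eq
  generalize D⁻ = u at *
  rw [hD]
  linear_combination (-h + g * algebraMap ℝ A (1 + r)) * h3 - g * h1

lemma mk_Dm (harch : ∀ f g : A, (∀ n : ℕ, (n : ℝ) • f ≤ g) → f ≤ 0)
    (hfalg : ∀ a b c : A, a ⊓ b = 0 → 0 ≤ c → (c * a) ⊓ b = 0)
    {r : ℝ} (hr0 : 0 ≤ r) {g h y z : A}
    (hg0 : 0 ≤ g) (hy : 0 ≤ y) (hz : 0 ≤ z)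
    (h1 : 0 ≤ y * h - g * (algebraMap ℝ A (1 + r) * y - algebraMap ℝ A r * z)) (m : ℕ) :
    0 ≤ y ^ (m + 1) * h - g * z ^ m *
      (algebraMap ℝ A ((m + 1 : ℕ) + r) * y - algebraMap ℝ A (m + r) * z) := by
  have hsq := mk_sq_nonneg (fun a b => mul_nonneg (a := a) (b := b)) hfalg (y - z)
  induction m with
  | zero => simpa using h1
  | succ m ih =>
    have e1 := mul_nonneg hy ih
    have e2 := mul_nonneg (mul_nonneg (mul_nonneg
      (mk_C_nonneg (A := A) (t := (m + 1 : ℕ) + r) (by positivity)) hg0) (pow_nonneg hz m)) hsq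
    convert add_nonneg e1 e2 using 1
    push_cast
    ring

end Helpers

section Powers

variable {A : Type*} [CommRing A] [Lattice A]

lemma mk_abs_sum {ι : Type*} [IsOrderedAddMonoid A] (F : Finset ι) (a : ι → A) :
    |∑ k ∈ F, a k| ≤ ∑ k ∈ F, |a k| := by
  classical
  induction F using Finset.induction_on with
  | empty => simp
  | insert i F hi ih =>
    rw [Finset.sum_insert hi, Finset.sum_insert hi]
    exact (abs_add_le _ _).trans (add_le_add le_rfl ih)

lemma mk_sum_glb {ι : Type*} [IsOrderedAddMonoid A] (F : Finset ι) (S : ι → Set A) (d : ι → A)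
    (hd : ∀ k, IsGLB (S k) (d k)) :
    ∀ s : A, (∀ e : ι → A, (∀ k, k ∈ F → e k ∈ S k) → s ≤ ∑ k ∈ F, e k) → s ≤ ∑ k ∈ F, d k := by
  classical
  induction F using Finset.induction_on with
  | empty => intro s h; simpa using h (fun _ => 0) (by simp)
  | insert a F ha ih =>
    intro s h
    rw [Finset.sum_insert ha, ← sub_le_iff_le_add]
    apply (hd a).2
    intro x hx
    rw [sub_le_comm]
    apply ih
    intro e he
    have := h (Function.update e a x) (by
      intro k hk
      by_cases hka : k = a
      · subst hka; simpa using hx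
      · rw [Function.update_of_ne hka]
        exact he k ((Finset.mem_insert.1 hk).resolve_left hka))
    rw [Finset.sum_insert ha, Function.update_self] at this
    rw [sub_le_iff_le_add']
    convert this using 2
    apply Finset.sum_congr rfl
    intro k hk
    rw [Function.update_of_ne]
    rintro rfl
    exact ha hk

variable [IsOrderedRing A] [Algebra ℝ A] [PosSMulMono ℝ A]

lemma mk_pow_nonneg {r : ℝ} (hr : 0 ≤ r) {a g : A} (ha : 0 ≤ a) (hg : IsGLB (rpowSet a r) g) :
    0 ≤ g := by
  apply hg.2
  rintro x ⟨θ₁, θ₂, h1, h2, -, rfl⟩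
  have hf1 := Nat.floor_le hr
  have hf2 := Nat.lt_floor_add_one r
  exact add_nonneg (smul_nonneg (mul_nonneg (by linarith) h1.le) ha)
    (smul_nonneg (mul_nonneg (by linarith) h2.le) zero_le_one)

lemma mk_pow_upper {r q : ℝ} (hq : q = r - (⌊r⌋₊ : ℝ))
    {a g : A} (hg : IsGLB (rpowSet a r) g) (s : ℝ) (hs : 0 < s) :
    g ≤ algebraMap ℝ A (q * s ^ (q - 1)) * a + algebraMap ℝ A ((1 - q) * s ^ q) := by
  apply hg.1
  refine ⟨s ^ (q - 1), s ^ q, Real.rpow_pos_of_pos hs _, Real.rpow_pos_of_pos hs _, ?_, ?_⟩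
  · rw [← hq, ← Real.rpow_mul hs.le, ← Real.rpow_mul hs.le, ← Real.rpow_add hs]
    ring_nf
    exact Real.rpow_zero s
  · rw [← hq, Algebra.smul_def, Algebra.smul_def, mul_one]

lemma mk_pow_lower {r q : ℝ} (hq : q = r - (⌊r⌋₊ : ℝ)) (hq0 : 0 ≤ q) (hq1 : q ≤ 1)
    {a g : A} (ha : 0 ≤ a) (hg : IsGLB (rpowSet a r) g) (s : ℝ) (hs : 0 < s) :
    algebraMap ℝ A (s ^ (q - 1)) * (a ⊓ algebraMap ℝ A s) ≤ g := by
  apply hg.2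
  rintro x ⟨θ₁, θ₂, h1, h2, h3, rfl⟩
  rw [← hq] at *
  set e := a ⊓ algebraMap ℝ A s with he
  have he0 : 0 ≤ e := le_inf ha (mk_C_nonneg hs.le)
  have he1 : e ≤ a := inf_le_left
  have he2 : e ≤ algebraMap ℝ A s := inf_le_right
  have hreal : s ^ (q - 1) ≤ q * θ₁ + (1 - q) * (θ₂ / s) := by
    have := Real.geom_mean_le_arith_mean2_weighted hq0 (sub_nonneg.2 hq1) h1.le
      (div_pos h2 hs).le (by ring)
    refine le_trans (le_of_eq ?_) this
    rw [Real.div_rpow h2.le hs.le, mul_div_assoc', h3, one_div, ← Real.rpow_neg hs.le]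
    ring_nf
  rw [Algebra.smul_def, Algebra.smul_def, mul_one]
  have e1 := mul_le_mul_of_nonneg_right (mk_C_mono (A := A) hreal) he0
  have e2 := mul_le_mul_of_nonneg_left he1 (mk_C_nonneg (A := A) (mul_nonneg hq0 h1.le))
  have e3 := mul_le_mul_of_nonneg_left he2
    (mk_C_nonneg (A := A) (mul_nonneg (sub_nonneg.2 hq1) (div_pos h2 hs).le))
  rw [← map_mul (algebraMap ℝ A) _ s, mul_assoc, div_mul_cancel₀ _ hs.ne'] at e3
  refine e1.trans (le_trans (le_of_eq ?_) (add_le_add e2 e3))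
  rw [map_add]; ring

lemma mk_pow_zero {r : ℝ} (hq : r - (⌊r⌋₊ : ℝ) = 0) {a g : A}
    (hg : IsGLB (rpowSet a r) g) : g = 1 := by
  have : rpowSet a r = {1} := by
    ext x
    simp only [rpowSet, hq, Set.mem_setOf_eq, Set.mem_singleton_iff]
    constructor
    · rintro ⟨θ₁, θ₂, h1, h2, h3, rfl⟩
      simp at h3
      simp [h3]
    · rintro rfl
      exact ⟨1, 1, by simp⟩
  rw [this] at hg
  exact hg.unique isGLB_singleton

lemma mk_pow_homog {r q : ℝ} (hq : q = r - (⌊r⌋₊ : ℝ)) {a g : A} {μ : ℝ} (hμ : 0 < μ)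
    (hg : IsGLB (rpowSet a r) g) : IsGLB (rpowSet (μ • a) r) (μ ^ q • g) := by
  have key : ∀ (a : A) (μ : ℝ), 0 < μ → ∀ x ∈ rpowSet (μ • a) r, μ ^ (-q) • x ∈ rpowSet a r := by
    rintro a μ hμ x ⟨θ₁, θ₂, h1, h2, h3, rfl⟩
    refine ⟨μ ^ (-q) * μ * θ₁, μ ^ (-q) * θ₂, by positivity, by positivity, ?_, ?_⟩
    · rw [← hq] at *
      have hp := Real.rpow_pos_of_pos hμ (-q)
      rw [Real.mul_rpow (by positivity) h1.le, Real.mul_rpow hp.le h2.le,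
        Real.mul_rpow hp.le hμ.le, ← Real.rpow_mul hμ.le, ← Real.rpow_mul hμ.le]
      calc _ = (μ ^ (-q * q) * μ ^ q * μ ^ (-q * (1 - q))) * (θ₁ ^ q * θ₂ ^ (1 - q)) := by ring
        _ = 1 := by
          rw [h3, ← Real.rpow_add hμ, ← Real.rpow_add hμ]
          ring_nf
          exact Real.rpow_zero μ
    · rw [smul_add, smul_smul, smul_smul, smul_smul]
      congr 2 <;> ring
  have hp := Real.rpow_pos_of_pos hμ q
  have hpn := Real.rpow_pos_of_pos hμ (-q)
  have hinv : μ ^ q * μ ^ (-q) = 1 := by rw [← Real.rpow_add hμ]; simp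
  constructor
  · intro x hx
    have := smul_le_smul_of_nonneg_left (hg.1 (key a μ hμ x hx)) hp.le
    rwa [smul_smul, hinv, one_smul] at this
  · intro b hb
    have h1 : μ ^ (-q) • b ≤ g := by
      apply hg.2
      intro x hx
      have h2 := key (μ • a) μ⁻¹ (inv_pos.2 hμ) x (by rwa [smul_smul, inv_mul_cancel₀ hμ.ne', one_smul])
      have h3 : (μ⁻¹) ^ (-q) = μ ^ q := by
        rw [Real.inv_rpow hμ.le, Real.rpow_neg hμ.le, inv_inv]
      rw [h3] at h2
      have := smul_le_smul_of_nonneg_left (hb h2) hpn.le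
      rwa [smul_smul, mul_comm, hinv, one_smul] at this
    have := smul_le_smul_of_nonneg_left h1 hp.le
    rwa [smul_smul, hinv, one_smul] at this

/-- Scalar convexity of the `p`-th power. -/
lemma mk_convex (harch : ∀ f g : A, (∀ n : ℕ, (n : ℝ) • f ≤ g) → f ≤ 0)
    (hfalg : ∀ a b c : A, a ⊓ b = 0 → 0 ≤ c → (c * a) ⊓ b = 0)
    {p : ℝ} (hp : 1 < p) {n : ℕ} (a : Fin n → A)
    (c : A) (hc : IsRPow |∑ k, a k| p c)
    (ck : Fin n → A) (hck : ∀ k, IsRPow |a k| p (ck k))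
    (l : Fin n → ℝ) (hl : ∀ k, 0 < l k) (hl1 : ∑ k, l k = 1) :
    c ≤ ∑ k, (l k ^ (1 - p)) • ck k := by
  obtain ⟨g, hg, rfl⟩ := hc
  set x := |∑ k, a k| with hx
  have hx0 : 0 ≤ x := abs_nonneg _
  have hp0 : 0 ≤ p := by linarith
  obtain ⟨m, hm⟩ : ∃ m, ⌊p⌋₊ = m + 1 :=
    ⟨⌊p⌋₊ - 1, by have : 1 ≤ ⌊p⌋₊ := Nat.le_floor (by simpa using hp.le); omega⟩
  obtain ⟨q, hq⟩ : ∃ q, q = p - (⌊p⌋₊ : ℝ) := ⟨_, rfl⟩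
  have hq0 : 0 ≤ q := by have := Nat.floor_le hp0; linarith
  have hq1 : q < 1 := by have := Nat.lt_floor_add_one p; linarith
  have hg0 := mk_pow_nonneg hp0 hx0 hg
  have hpq : p = (m + 1 : ℕ) + q := by rw [hq, hm]; ring
  have hk : ∀ k, g * x ^ m * (algebraMap ℝ A p * |a k| - algebraMap ℝ A ((p - 1) * l k) * x)
      ≤ (l k ^ (1 - p)) • ck k := by
    intro k
    obtain ⟨h, hh, hch⟩ := hck k
    have hμ : 0 < (l k)⁻¹ := inv_pos.2 (hl k)
    have hh' := mk_pow_homog hq hμ hh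
    have hy0 : 0 ≤ (l k)⁻¹ • |a k| := smul_nonneg hμ.le (abs_nonneg _)
    have hD1 : 0 ≤ ((l k)⁻¹ • |a k|) * ((l k)⁻¹ ^ q • h) -
        g * (algebraMap ℝ A (1 + q) * ((l k)⁻¹ • |a k|) - algebraMap ℝ A q * x) := by
      rcases hq0.eq_or_lt with h0 | h0
      · have e1 := mk_pow_zero (by rw [← hq, ← h0]) hg
        have e2 := mk_pow_zero (by rw [← hq, ← h0]) hh'
        rw [e1, e2, ← h0]
        simp
      · exact mk_D1 harch hfalg h0 hq1 hg0 (mk_pow_nonneg hp0 hy0 hh') hy0 hx0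
          (mk_pow_upper hq hg) (mk_pow_lower hq hq0 hq1.le hy0 hh')
    have hDm := mk_Dm harch hfalg hq0 hg0 hy0 hx0 hD1 m
    have hlm := mul_nonneg (mk_C_nonneg (A := A) (hl k).le) hDm
    rw [← sub_nonneg]
    convert hlm using 1
    have r1 : l k ^ (1 - p) = l k * ((l k)⁻¹ ^ (m + 1) * (l k)⁻¹ ^ q) := by
      rw [← Real.rpow_natCast, ← Real.rpow_add hμ, ← hpq, Real.inv_rpow (hl k).le,
        Real.rpow_sub (hl k), Real.rpow_one, div_eq_mul_inv]
    have r2 : (m : ℝ) + q = p - 1 := by rw [hpq]; push_cast; ring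
    have r3 : algebraMap ℝ A (l k) * algebraMap ℝ A (l k)⁻¹ = 1 := by
      rw [← map_mul, mul_inv_cancel₀ (hl k).ne', map_one]
    rw [r1, hch, ← hpq, r2, hm]
    simp only [Algebra.smul_def, map_mul, map_pow]
    linear_combination (g * x ^ m * algebraMap ℝ A p * |a k|) * r3
  refine le_trans ?_ (Finset.sum_le_sum fun k _ => hk k)
  rw [← Finset.mul_sum, Finset.sum_sub_distrib, ← Finset.mul_sum, ← Finset.sum_mul, ← map_sum,
    ← Finset.mul_sum, hl1, hm, mul_one, ← sub_nonneg]
  have habs : x ≤ ∑ k, |a k| := mk_abs_sum _ _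
  have := mul_nonneg (mul_nonneg (mul_nonneg hg0 (pow_nonneg hx0 m)) (mk_C_nonneg (A := A) hp0))
    (sub_nonneg.2 habs)
  convert this using 1
  rw [map_sub, map_one]
  ring

end Powers

/-- **Theorem 5.1 (real case), Minkowski inequality.** For `p ∈ (1,∞)` and a positive linear
map `T : A → B` between weighted geometric mean closed Archimedean `Φ`-algebras,
`(T(|Σₖ aₖ|^p))^{1/p} ≤ Σₖ (T(|aₖ|^p))^{1/p}`; here `c = |Σₖ aₖ|^p` and `cₖ = |aₖ|^p` in `A`,
while `s = (T c)^{1/p}` and `dₖ = (T cₖ)^{1/p}` in `B`. -/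
theorem stmt19 {A : Type*} [CommRing A] [Lattice A]
    [CovariantClass A A (· + ·) (· ≤ ·)]
    [Algebra ℝ A] [PosSMulMono ℝ A]
    {B : Type*} [CommRing B] [Lattice B]
    [CovariantClass B B (· + ·) (· ≤ ·)]
    [Algebra ℝ B] [PosSMulMono ℝ B]
    (harchA : ∀ f g : A, (∀ n : ℕ, (n : ℝ) • f ≤ g) → f ≤ 0)
    (hmulposA : ∀ a b : A, 0 ≤ a → 0 ≤ b → 0 ≤ a * b)
    (hfalgA : ∀ a b c : A, a ⊓ b = 0 → 0 ≤ c → (c * a) ⊓ b = 0)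
    (hwgmA : ∀ (n : ℕ) (f : Fin n → A) (r : Fin n → ℝ),
      (∀ k, 0 < r k ∧ r k < 1) → (∑ k, r k) = 1 →
      ∃ m, IsGLB {x | ∃ θ : Fin n → ℝ, (∀ k, 0 < θ k) ∧ (∏ k, θ k ^ r k) = 1 ∧
        x = ∑ k, (r k * θ k) • |f k|} m)
    (harchB : ∀ f g : B, (∀ n : ℕ, (n : ℝ) • f ≤ g) → f ≤ 0)
    (hmulposB : ∀ a b : B, 0 ≤ a → 0 ≤ b → 0 ≤ a * b)
    (hfalgB : ∀ a b c : B, a ⊓ b = 0 → 0 ≤ c → (c * a) ⊓ b = 0)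
    (hwgmB : ∀ (n : ℕ) (f : Fin n → B) (r : Fin n → ℝ),
      (∀ k, 0 < r k ∧ r k < 1) → (∑ k, r k) = 1 →
      ∃ m, IsGLB {x | ∃ θ : Fin n → ℝ, (∀ k, 0 < θ k) ∧ (∏ k, θ k ^ r k) = 1 ∧
        x = ∑ k, (r k * θ k) • |f k|} m)
    (p : ℝ) (hp : 1 < p)
    (T : A →ₗ[ℝ] B) (hT : ∀ x : A, 0 ≤ x → 0 ≤ T x)
    (n : ℕ) (hn : 1 ≤ n) (a : Fin n → A)
    (c : A) (hc : IsRPow |∑ k, a k| p c)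
    (s : B) (hs : IsRPow (T c) p⁻¹ s)
    (ck : Fin n → A) (hck : ∀ k, IsRPow |a k| p (ck k))
    (d : Fin n → B) (hd : ∀ k, IsRPow (T (ck k)) p⁻¹ (d k)) :
    s ≤ ∑ k, d k := by
  have iA : IsOrderedAddMonoid A := mk_ordered
  have iB : IsOrderedAddMonoid B := mk_ordered
  have : ZeroLEOneClass A := ⟨mk_zero_le_one hmulposA hfalgA⟩
  have : IsOrderedRing A := IsOrderedRing.of_mul_nonneg hmulposA
  have hpi0 : 0 < p⁻¹ := by positivity
  have hpi1 : p⁻¹ < 1 := inv_lt_one_of_one_lt₀ hp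
  have hp0 : 0 < p := by linarith
  have hfl : ⌊p⁻¹⌋₊ = 0 := Nat.floor_eq_zero.2 hpi1
  obtain ⟨s', hs', rfl⟩ := hs
  choose d' hd' hdd using hd
  have hdd' : d = d' := by
    funext k; rw [hdd k, hfl, pow_zero, one_mul]
  subst hdd'
  rw [hfl, pow_zero, one_mul]
  apply mk_sum_glb Finset.univ (fun k => rpowSet (T (ck k)) p⁻¹) d hd'
  intro e he
  have he' : ∀ k, ∃ φ : ℝ, 0 < φ ∧
      e k = (p⁻¹ * φ ^ (1 - p)) • T (ck k) + ((1 - p⁻¹) * φ) • (1 : B) := by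
    intro k
    obtain ⟨θ₁, θ₂, h1, h2, h3, h4⟩ := he k (Finset.mem_univ k)
    simp only [hfl, Nat.cast_zero, sub_zero] at h3 h4
    refine ⟨θ₂, h2, ?_⟩
    have : θ₁ = θ₂ ^ (1 - p) := by
      have h5 : θ₁ ^ p⁻¹ = (θ₂ ^ (1 - p⁻¹))⁻¹ := eq_inv_of_mul_eq_one_left h3
      have h6 : θ₁ = (θ₁ ^ p⁻¹) ^ p := by
        rw [← Real.rpow_mul h1.le, inv_mul_cancel₀ hp0.ne', Real.rpow_one]
      rw [h6, h5, ← Real.rpow_neg h2.le, ← Real.rpow_mul h2.le]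
      congr 1
      field_simp
      ring
    rw [h4, this]
  choose φ hφ heφ using he'
  have : Nonempty (Fin n) := ⟨⟨0, hn⟩⟩
  obtain ⟨Φ, hΦ⟩ : ∃ Φ, Φ = ∑ k, φ k := ⟨_, rfl⟩
  have hΦ0 : 0 < Φ := by
    rw [hΦ]; exact Finset.sum_pos (fun k _ => hφ k) Finset.univ_nonempty
  have hconv := mk_convex harchA hfalgA hp a c hc ck hck (fun k => φ k / Φ)
    (fun k => div_pos (hφ k) hΦ0) (by rw [← Finset.sum_div, ← hΦ, div_self hΦ0.ne'])
  have hTc : T c ≤ ∑ k, ((φ k / Φ) ^ (1 - p)) • T (ck k) := by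
    have := hT _ (sub_nonneg.2 hconv)
    rw [map_sub, sub_nonneg, map_sum] at this
    simpa only [map_smul] using this
  have hmem : (p⁻¹ * Φ ^ (1 - p)) • T c + ((1 - p⁻¹) * Φ) • (1 : B) ∈ rpowSet (T c) p⁻¹ := by
    refine ⟨Φ ^ (1 - p), Φ, by positivity, hΦ0, ?_, ?_⟩
    · simp only [hfl, Nat.cast_zero, sub_zero]
      rw [← Real.rpow_mul hΦ0.le, ← Real.rpow_add hΦ0]
      have : (1 - p) * p⁻¹ + (1 - p⁻¹) = 0 := by field_simp; ring
      rw [this, Real.rpow_zero]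
    · simp only [hfl, Nat.cast_zero, sub_zero]
  refine (hs'.1 hmem).trans ?_
  have h1 := smul_le_smul_of_nonneg_left hTc
    (show 0 ≤ p⁻¹ * Φ ^ (1 - p) by positivity)
  refine (add_le_add_left h1 _).trans (le_of_eq ?_)
  simp only [heφ]
  rw [Finset.sum_add_distrib, ← Finset.sum_smul, ← Finset.mul_sum, ← hΦ, Finset.smul_sum]
  congr 1
  apply Finset.sum_congr rfl
  intro k _
  rw [smul_smul, Real.div_rpow (hφ k).le hΦ0.le]
  congr 1
  have := (Real.rpow_pos_of_pos hΦ0 (1 - p)).ne'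
  field_simp
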